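/- arXiv:2409.00390 — 15 statements merged into one kernel-verified Lean document; each statement's English description precedes it below -/
import Mathlib

section
/- A nearly associative algebra A over a field K of characteristic zero is flexible (i.e., (x*y)*x = x*(y*x) for all x,y ∈ A) if and only if every symmetrized product x∘y lies in the center of the commutator algebra A⁻, i.e., for all x, y, z ∈ A one has (x∘y)*z = z*(x∘y). -/
/-- A nearly associative algebra is flexible iff every symmetrized
product `x∘y` lies in the center of `A⁻`. -/
theorem stmt1 {K A : Type*} [Field K] [CharZero K] [AddCommGroup A] [Module K A]
    (mul : A →ₗ[K] A →ₗ[K] A)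
    (hNA : ∀ x y z : A, mul (mul x y) z = mul y (mul z x))
    (circ : A → A → A)
    (hcirc : ∀ x y : A, circ x y = (2 : K)⁻¹ • (mul x y + mul y x)) :
    (∀ x y : A, mul (mul x y) x = mul x (mul y x)) ↔
      (∀ x y z : A, mul (circ x y) z = mul z (circ x y)) := by
  constructor
  · intro hflex x y z
    have hlin : mul (mul x z) y + mul (mul y z) x = mul x (mul z y) + mul y (mul z x) := by
      have h := hflex (x + y) z
      simp only [map_add, LinearMap.add_apply] at h
      linear_combination (norm := module) h - hflex x z - hflex y z
    simp only [hcirc, map_smul, map_add, LinearMap.smul_apply, LinearMap.add_apply]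
    rw [hNA x y z, hNA y x z, ← hNA x z y, ← hNA y z x,
      add_comm (mul (mul y z) x), hlin, add_comm]
  · intro hcenter x y
    have hsq : circ x x = mul x x := by
      rw [hcirc, ← two_smul K, inv_smul_smul₀ two_ne_zero]
    have h := hcenter x x y
    rw [hsq] at h
    rw [hNA x y x, ← h, hNA x x y]
end

section
/- Let (A, B) be a quadratic algebra over a field K of characteristic zero, i.e., B is a symmetric, non-degenerate, invariant bilinear form on A. Then A is nearly associative if and only if A is an LR-algebra. -/
/-- A quadratic algebra is nearly associative iff it is an LR-algebra. -/
theorem stmt3 {K A : Type*} [Field K] [CharZero K] [AddCommGroup A] [Module K A]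
    (mul : A →ₗ[K] A →ₗ[K] A) (B : A →ₗ[K] A →ₗ[K] K)
    (hsymm : ∀ x y : A, B x y = B y x)
    (hnondeg : ∀ x : A, (∀ y : A, B x y = 0) → x = 0)
    (hinv : ∀ x y z : A, B (mul x y) z = B x (mul y z)) :
    (∀ x y z : A, mul (mul x y) z = mul y (mul z x)) ↔
      ((∀ x y z : A, mul x (mul y z) = mul y (mul x z)) ∧
        (∀ x y z : A, mul (mul x y) z = mul (mul x z) y)) := by
  have ext_form : ∀ a b : A, (∀ w, B a w = B b w) → a = b := fun a b h =>
    sub_eq_zero.1 (hnondeg _ fun w => by simp [h w])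
  have swap : ∀ x y z w : A, B (mul x y) (mul z w) = B (mul z w) (mul x y) :=
    fun x y z w => hsymm _ _
  have form_left : ∀ x y z w : A, B (mul x (mul y z)) w = B (mul y z) (mul w x) :=
    fun x y z w => by rw [hinv, hsymm, hinv]
  constructor
  · intro h
    have rot : ∀ x y z w : A, B (mul x y) (mul z w) = B (mul z x) (mul w y) :=
      fun x y z w => by rw [← hinv, h, form_left]
    refine ⟨fun x y z => ext_form _ _ fun w => ?_, fun x y z => ext_form _ _ fun w => ?_⟩
    · rw [form_left, form_left, rot, swap]
    · rw [hinv (mul x y), hinv (mul x z), rot x y, rot z x, rot x z, swap]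
  · rintro ⟨hL, hR⟩ x y z
    have swap_outer : ∀ x y z w : A, B (mul x y) (mul z w) = B (mul w y) (mul z x) :=
      fun x y z w => by rw [← form_left, hL, form_left]
    have swap_inner : ∀ x y z w : A, B (mul x y) (mul z w) = B (mul x z) (mul y w) :=
      fun x y z w => by rw [← hinv, hR, hinv]
    refine ext_form _ _ fun w => ?_
    rw [hinv, form_left, swap_inner, swap_outer, swap z x, swap_inner w y]
end

section
/- Let (A, B) be a quadratic algebra over a field K of characteristic zero, i.e., B is a symmetric, non-degenerate, invariant bilinear form on A. Then the following three conditions are equivalent: (1) A is an R-algebra; (2) A is an L-algebra; (3) A is nearly associative. -/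
section

variable {K A : Type*} [Field K] [AddCommGroup A] [Module K A]
  {mul : A →ₗ[K] A →ₗ[K] A} {B : A →ₗ[K] A →ₗ[K] K}

/-- Elements of a space with a non-degenerate form are separated by the form. -/
theorem eq_iff_forall_form_eq (hnondeg : ∀ x : A, (∀ y : A, B x y = 0) → x = 0) (a b : A) :
    a = b ↔ ∀ w : A, B a w = B b w := by
  refine ⟨fun h w => by rw [h], fun h => sub_eq_zero.mp (hnondeg _ fun w => ?_)⟩
  rw [map_sub, LinearMap.sub_apply, h w, sub_self]

/-- The left-commutative identity says that `B (x * y) (z * w)` is symmetric in `y` and `z`. -/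
theorem left_comm_iff_form (hsymm : ∀ x y : A, B x y = B y x)
    (hnondeg : ∀ x : A, (∀ y : A, B x y = 0) → x = 0)
    (hinv : ∀ x y z : A, B (mul x y) z = B x (mul y z)) :
    (∀ x y z : A, mul x (mul y z) = mul y (mul x z)) ↔
      ∀ x y z w : A, B (mul x y) (mul z w) = B (mul x z) (mul y w) := by
  simp only [eq_iff_forall_form_eq hnondeg, hsymm (mul _ (mul _ _)), ← hinv _ _ (mul _ _)]
  exact ⟨fun h x y z w => h y z w x, fun h x y z w => h w x y z⟩

/-- The right-commutative identity says that `B (x * y) (z * w)` is symmetric in `y` and `z`. -/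
theorem right_comm_iff_form (hnondeg : ∀ x : A, (∀ y : A, B x y = 0) → x = 0)
    (hinv : ∀ x y z : A, B (mul x y) z = B x (mul y z)) :
    (∀ x y z : A, mul (mul x y) z = mul (mul x z) y) ↔
      ∀ x y z w : A, B (mul x y) (mul z w) = B (mul x z) (mul y w) := by
  simp only [eq_iff_forall_form_eq hnondeg, hinv (mul _ _)]

/-- Near associativity says that `B (x * y) (z * w)` is symmetric in `x` and `w`. -/
theorem nearly_assoc_iff_form (hsymm : ∀ x y : A, B x y = B y x)
    (hnondeg : ∀ x : A, (∀ y : A, B x y = 0) → x = 0)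
    (hinv : ∀ x y z : A, B (mul x y) z = B x (mul y z)) :
    (∀ x y z : A, mul (mul x y) z = mul y (mul z x)) ↔
      ∀ x y z w : A, B (mul x y) (mul z w) = B (mul w y) (mul z x) := by
  simp only [eq_iff_forall_form_eq hnondeg, hsymm (mul _ (mul _ _)), hinv (mul _ _),
    ← hinv _ _ (mul _ _)]

end

/-- For a quadratic algebra, being an R-algebra, an L-algebra,
and nearly associative are equivalent. -/
theorem stmt4 {K A : Type*} [Field K] [CharZero K] [AddCommGroup A] [Module K A]
    (mul : A →ₗ[K] A →ₗ[K] A) (B : A →ₗ[K] A →ₗ[K] K)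
    (hsymm : ∀ x y : A, B x y = B y x)
    (hnondeg : ∀ x : A, (∀ y : A, B x y = 0) → x = 0)
    (hinv : ∀ x y z : A, B (mul x y) z = B x (mul y z)) :
    ((∀ x y z : A, mul (mul x y) z = mul (mul x z) y) ↔
      (∀ x y z : A, mul x (mul y z) = mul y (mul x z))) ∧
    ((∀ x y z : A, mul x (mul y z) = mul y (mul x z)) ↔
      (∀ x y z : A, mul (mul x y) z = mul y (mul z x))) := by
  rw [right_comm_iff_form hnondeg hinv, left_comm_iff_form hsymm hnondeg hinv,
    nearly_assoc_iff_form hsymm hnondeg hinv]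
  refine ⟨Iff.rfl, fun h x y z w => ?_, fun h x y z w => ?_⟩
  · rw [hsymm, h, hsymm]
  · rw [hsymm, h, hsymm]
end

section
/- Let A be a nearly associative algebra over a field K of characteristic zero, V a K-vector space, and l, r : A → End(V) linear maps. Equip the vector space A ⊕ V with the product (x,u) ∗ (y,v) := (x*y, l(x)(v) + r(y)(u)). Then (A ⊕ V, ∗) is a nearly associative algebra if and only if for all x, y ∈ A: l(x)∘l(y) = r(y)∘r(x), l(x)∘r(y) = l(y*x), and r(x)∘l(y) = r(x*y). -/
/-- `A ⊕ V` with the product `(x,u) ∗ (y,v) = (x*y, l(x)v + r(y)u)`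
is nearly associative iff `l(x)l(y) = r(y)r(x)`, `l(x)r(y) = l(y*x)`,
`r(x)l(y) = r(x*y)` for all `x, y ∈ A`. -/
theorem stmt5 {K A V : Type*} [Field K] [CharZero K] [AddCommGroup A] [Module K A]
    [AddCommGroup V] [Module K V]
    (mul : A →ₗ[K] A →ₗ[K] A)
    (hNA : ∀ x y z : A, mul (mul x y) z = mul y (mul z x))
    (l r : A →ₗ[K] Module.End K V)
    (pmul : A × V → A × V → A × V)
    (hpmul : ∀ p q : A × V, pmul p q = (mul p.1 q.1, l p.1 q.2 + r q.1 p.2)) :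
    (∀ p q s : A × V, pmul (pmul p q) s = pmul q (pmul s p)) ↔
      (∀ x y : A, l x * l y = r y * r x ∧ l x * r y = l (mul y x) ∧
        r x * l y = r (mul x y)) := by
  simp only [hpmul, Prod.ext_iff, LinearMap.ext_iff, Module.End.mul_apply]
  constructor
  · intro h x y
    refine ⟨fun v => ?_, fun v => ?_, fun v => ?_⟩
    · simpa using (h (0, v) (x, 0) (y, 0)).2.symm
    · simpa using (h (y, 0) (x, 0) (0, v)).2.symm
    · simpa using (h (y, 0) (0, v) (x, 0)).2
  · rintro h ⟨x, u⟩ ⟨y, v⟩ ⟨z, w⟩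
    refine ⟨hNA x y z, ?_⟩
    simp only [map_add, (h y z).1, (h y x).2.1, (h z x).2.2]
    abel
end

section
/- Let A be a finite-dimensional nearly associative algebra over a field K of characteristic zero, with left and right multiplication operators L_x(y) = x*y and R_x(y) = y*x, and dual operators L*_x, R*_x on the dual space A* defined by L*_x(f) := f ∘ R_x and R*_x(f) := f ∘ L_x. Then (R*, L*) is a representation of A in A* (i.e., L*_x ∘ L*_y = R*_y ∘ R*_x, L*_x ∘ R*_y = L*_{y*x}, and R*_x ∘ L*_y = R*_{x*y} for all x,y ∈ A) if and only if L_{x*y} = R_{y*x} for all x,y ∈ A, i.e., (x*y)*z = z*(y*x) for all x,y,z ∈ A. -/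
/-- `(R*, L*)` is a representation of a nearly associative algebra `A`
in `A*` iff `L_{x*y} = R_{y*x}`, i.e. `(x*y)*z = z*(y*x)`. -/
theorem stmt6 {K A : Type*} [Field K] [CharZero K] [AddCommGroup A] [Module K A]
    [FiniteDimensional K A]
    (mul : A →ₗ[K] A →ₗ[K] A)
    (hNA : ∀ x y z : A, mul (mul x y) z = mul y (mul z x))
    (Ls Rs : A → Module.Dual K A → Module.Dual K A)
    (hLs : ∀ (x : A) (f : Module.Dual K A), Ls x f = LinearMap.comp f (mul.flip x))
    (hRs : ∀ (x : A) (f : Module.Dual K A), Rs x f = LinearMap.comp f (mul x)) :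
    ((∀ (x y : A) (f : Module.Dual K A), Ls x (Ls y f) = Rs y (Rs x f)) ∧
      (∀ (x y : A) (f : Module.Dual K A), Ls x (Rs y f) = Ls (mul y x) f) ∧
      (∀ (x y : A) (f : Module.Dual K A), Rs x (Ls y f) = Rs (mul x y) f)) ↔
    (∀ x y z : A, mul (mul x y) z = mul z (mul y x)) := by
  constructor
  · rintro ⟨-, h, -⟩ x y z
    rw [hNA, ← sub_eq_zero, ← Module.forall_dual_apply_eq_zero_iff K]
    intro f
    have := LinearMap.congr_fun (h x y f) z
    simp only [hLs, hRs, LinearMap.comp_apply, LinearMap.flip_apply] at this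
    rw [map_sub, this, sub_self]
  · intro h
    have left_comm (x y z : A) : mul y (mul z x) = mul z (mul y x) := by rw [← hNA, h]
    refine ⟨fun x y f => ?_, fun x y f => ?_, fun x y f => ?_⟩ <;> ext a <;>
      simp only [hLs, hRs, LinearMap.comp_apply, LinearMap.flip_apply]
    · rw [hNA]
    · rw [left_comm]
    · rw [hNA, hNA, left_comm]
end

section
/- Let A be a finite-dimensional nearly associative algebra over a field K of characteristic zero, with dual operators L*_x(f) := f ∘ R_x and R*_x(f) := f ∘ L_x on A*. Then the following are equivalent: (1) (R*, L*) is a representation of A in A*, i.e., L*_x ∘ L*_y = R*_y ∘ R*_x, L*_x ∘ R*_y = L*_{y*x}, and R*_x ∘ L*_y = R*_{x*y} for all x,y ∈ A; (2) A is an L-algebra; (3) A is an R-algebra. -/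
/-- For a nearly associative algebra `A`, the coadjoint pair
`(R*, L*)` being a representation of `A` in `A*`, `A` being an L-algebra,
and `A` being an R-algebra are equivalent. -/
theorem stmt7 {K A : Type*} [Field K] [CharZero K] [AddCommGroup A] [Module K A]
    [FiniteDimensional K A]
    (mul : A →ₗ[K] A →ₗ[K] A)
    (hNA : ∀ x y z : A, mul (mul x y) z = mul y (mul z x))
    (Ls Rs : A → Module.Dual K A → Module.Dual K A)
    (hLs : ∀ (x : A) (f : Module.Dual K A), Ls x f = LinearMap.comp f (mul.flip x))
    (hRs : ∀ (x : A) (f : Module.Dual K A), Rs x f = LinearMap.comp f (mul x)) :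
    (((∀ (x y : A) (f : Module.Dual K A), Ls x (Ls y f) = Rs y (Rs x f)) ∧
        (∀ (x y : A) (f : Module.Dual K A), Ls x (Rs y f) = Ls (mul y x) f) ∧
        (∀ (x y : A) (f : Module.Dual K A), Rs x (Ls y f) = Rs (mul x y) f)) ↔
      (∀ x y z : A, mul x (mul y z) = mul y (mul x z))) ∧
    ((∀ x y z : A, mul x (mul y z) = mul y (mul x z)) ↔
      (∀ x y z : A, mul (mul x y) z = mul (mul x z) y)) := by
  have hLR : (∀ x y z : A, mul x (mul y z) = mul y (mul x z)) ↔
      (∀ x y z : A, mul (mul x y) z = mul (mul x z) y) := by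
    constructor
    · intro h x y z
      rw [hNA, hNA, h]
    · intro h x y z
      rw [← hNA, ← hNA, h]
  refine ⟨⟨?_, ?_⟩, hLR⟩
  · rintro ⟨-, h, -⟩ x y z
    rw [← sub_eq_zero, ← Module.forall_dual_apply_eq_zero_iff K]
    intro f
    have hf := LinearMap.congr_fun (h z x f) y
    simp only [hLs, hRs, LinearMap.comp_apply, LinearMap.flip_apply] at hf
    rw [map_sub, hf, sub_self]
  · intro hL
    refine ⟨fun x y f => ?_, fun x y f => ?_, fun x y f => ?_⟩ <;> ext a <;>
      simp only [hLs, hRs, LinearMap.comp_apply, LinearMap.flip_apply]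
    · rw [hNA]
    · rw [hL]
    · rw [hLR.1 hL]
end

section
/- Let A be a finite-dimensional (not necessarily associative or unital) algebra over a field K of characteristic zero. Then there exists a bilinear form B on A making (A, B) a quadratic algebra if and only if there exists a linear isomorphism Φ : A → A* such that Φ(L_x(a)) = L*_x(Φ(a)) and Φ(R_x(a)) = R*_x(Φ(a)) for all x, a ∈ A, i.e., Φ(x*a) = Φ(a) ∘ R_x and Φ(a*x) = Φ(a) ∘ L_x. -/
/-- A finite-dimensional vector space carries a nondegenerate symmetric bilinear form. -/
theorem exists_symm_nondegenerate (K V : Type*) [Field K] [AddCommGroup V] [Module K V]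
    [FiniteDimensional K V] :
    ∃ g : V →ₗ[K] V →ₗ[K] K, (∀ x y, g x y = g y x) ∧ ∀ x, (∀ y, g x y = 0) → x = 0 := by
  let b := Module.finBasis K V
  refine ⟨b.toDual, fun x y ↦ ?_, fun x hx ↦ b.toDual_inj x (LinearMap.ext hx)⟩
  have h : b.toDual = b.toDual.flip := b.ext fun i ↦ b.ext fun j ↦ by
    simp only [LinearMap.flip_apply, Module.Basis.toDual_apply, eq_comm]
  exact LinearMap.congr_fun₂ h x y

/-- A symmetric form whose radical meets `S` trivially can be made nondegenerate without changing
its values on `S × V`. -/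
theorem exists_symm_nondegenerate_eq_on {K V : Type*} [Field K] [AddCommGroup V] [Module K V]
    [FiniteDimensional K V] (s : V →ₗ[K] V →ₗ[K] K) (hs : ∀ x y, s x y = s y x)
    (S : Submodule K V) (hS : Disjoint S (LinearMap.ker s)) :
    ∃ B : V →ₗ[K] V →ₗ[K] K, (∀ x y, B x y = B y x) ∧ (∀ x, (∀ y, B x y = 0) → x = 0) ∧
      ∀ x ∈ S, ∀ y, B x y = s x y := by
  obtain ⟨C, hSC, hC⟩ := hS.exists_isCompl
  obtain ⟨g, hg, hg'⟩ := exists_symm_nondegenerate K (LinearMap.ker s)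
  let p := Submodule.projectionOnto _ _ hC.symm
  refine ⟨s + g.compl₁₂ p p, fun x y ↦ ?_, fun x hx ↦ ?_, fun x hx y ↦ ?_⟩
  · simp [hs x y, hg (p x) (p y)]
  · have hpx : p x = 0 := hg' _ fun y ↦ by
      have hsy : s x y = 0 := by rw [hs, LinearMap.mem_ker.1 y.2, LinearMap.zero_apply]
      simpa [hsy, p] using hx y
    have hxs : x ∈ LinearMap.ker s :=
      LinearMap.mem_ker.2 (LinearMap.ext fun y ↦ by simpa [hpx] using hx y)
    simpa [p, Submodule.projectionOnto_apply_of_mem_left hC.symm hxs] using hpx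
  · have hpx : p x = 0 := (Submodule.projectionOnto_apply_eq_zero_iff hC.symm).2 (hSC hx)
    simp [hpx]

/-- The antisymmetric part of a bilinear form satisfying both invariance identities vanishes on
products. -/
theorem apply_mul_comm_of_invariant {K A : Type*} [Field K] [CharZero K] [AddCommGroup A]
    [Module K A] (mul : A →ₗ[K] A →ₗ[K] A) (b : A →ₗ[K] A →ₗ[K] K)
    (hl : ∀ x a z, b (mul x a) z = b a (mul z x)) (hr : ∀ x a z, b (mul a x) z = b a (mul x z))
    (x y z : A) : b (mul x y) z = b z (mul x y) := by
  have h₁ := hr y x z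
  have h₂ := hl x y z
  have h₃ := hr z y x
  have h₄ := hl y z x
  have h₅ := hr x z y
  have h₆ := hl z x y
  grind


/-- A finite-dimensional algebra carries an invariant scalar product
iff there is a linear isomorphism `Φ : A → A*` intertwining `L` with `L*` and
`R` with `R*`. -/
theorem stmt9 {K A : Type*} [Field K] [CharZero K] [AddCommGroup A] [Module K A]
    [FiniteDimensional K A]
    (mul : A →ₗ[K] A →ₗ[K] A) :
    (∃ B : A →ₗ[K] A →ₗ[K] K,
        (∀ x y : A, B x y = B y x) ∧
        (∀ x : A, (∀ y : A, B x y = 0) → x = 0) ∧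
        (∀ x y z : A, B (mul x y) z = B x (mul y z))) ↔
    (∃ Φ : A ≃ₗ[K] Module.Dual K A, ∀ x a : A,
        Φ (mul x a) = LinearMap.comp (Φ a) (mul.flip x) ∧
        Φ (mul a x) = LinearMap.comp (Φ a) (mul x)) := by
  constructor
  · rintro ⟨B, hsymm, hB, hinv⟩
    have hinj : Function.Injective B :=
      (injective_iff_map_eq_zero B).2 fun x hx ↦ hB x fun y ↦ by simp [hx]
    refine ⟨LinearMap.linearEquivOfInjective B hinj Subspace.dual_finrank_eq.symm,
      fun x a ↦ ⟨LinearMap.ext fun z ↦ ?_, LinearMap.ext fun z ↦ ?_⟩⟩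
    · simp [hsymm _ z, hsymm a, hinv]
    · simp [hinv]
  · rintro ⟨Φ, hΦ⟩
    let b : A →ₗ[K] A →ₗ[K] K := Φ.toLinearMap
    have hl (x a z) : b (mul x a) z = b a (mul z x) := LinearMap.congr_fun (hΦ x a).1 z
    have hr (x a z) : b (mul a x) z = b a (mul x z) := LinearMap.congr_fun (hΦ x a).2 z
    let s := b + b.flip
    let S := Submodule.span K {w | ∃ x y, w = mul x y}
    have hcomm : S ≤ LinearMap.ker (b - b.flip) := by
      refine Submodule.span_le.2 ?_
      rintro _ ⟨x, y, rfl⟩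
      refine LinearMap.mem_ker.2 (LinearMap.ext fun z ↦ ?_)
      simp [apply_mul_comm_of_invariant mul b hl hr x y z]
    have hs (x y) : s x y = s y x := by simp [s, add_comm]
    have hS : Disjoint S (LinearMap.ker s) := by
      refine Submodule.disjoint_def.2 fun x hx hxs ↦ Φ.map_eq_zero_iff.1 (LinearMap.ext fun y ↦ ?_)
      have h₁ : b x y - b y x = 0 := LinearMap.congr_fun (LinearMap.mem_ker.1 (hcomm hx)) y
      have h₂ : b x y + b y x = 0 := LinearMap.congr_fun (LinearMap.mem_ker.1 hxs) y
      change b x y = 0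
      grind
    obtain ⟨B, hsymm, hB, hBs⟩ := exists_symm_nondegenerate_eq_on s hs S hS
    have hmem (x y) : mul x y ∈ S := Submodule.subset_span ⟨x, y, rfl⟩
    refine ⟨B, hsymm, hB, fun x y z ↦ ?_⟩
    rw [hBs _ (hmem x y), hsymm, hBs _ (hmem y z), hs (mul y z)]
    simp [s, hr y x z, hl y z x]
end

section
/- If A is a nearly associative L-algebra over a field K of characteristic zero, then for all x, y, z ∈ A: x*(y*z) = y*(x*z) = (z*y)*x = (z*x)*y, and y*(z*x) = (x*y)*z = z*(y*x) = (x*z)*y. (Equivalently, as operators: L_x L_y = L_y L_x = R_x R_y = R_y R_x and L_y R_x = L_{x*y} = R_{y*x} = R_y L_x for all x,y ∈ A.) -/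
/-- In a nearly associative L-algebra,
`x*(y*z) = y*(x*z) = (z*y)*x = (z*x)*y` and
`y*(z*x) = (x*y)*z = z*(y*x) = (x*z)*y`. -/
theorem stmt10 {K A : Type*} [Field K] [CharZero K] [AddCommGroup A] [Module K A]
    (mul : A →ₗ[K] A →ₗ[K] A)
    (hNA : ∀ x y z : A, mul (mul x y) z = mul y (mul z x))
    (hL : ∀ x y z : A, mul x (mul y z) = mul y (mul x z)) :
    ∀ x y z : A,
      mul x (mul y z) = mul y (mul x z) ∧
      mul y (mul x z) = mul (mul z y) x ∧
      mul (mul z y) x = mul (mul z x) y ∧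
      mul y (mul z x) = mul (mul x y) z ∧
      mul (mul x y) z = mul z (mul y x) ∧
      mul z (mul y x) = mul (mul x z) y := by
  intro x y z
  exact ⟨hL x y z, (hNA z y x).symm, by rw [hNA z y x, hNA z x y, hL],
    (hNA x y z).symm, by rw [hNA x y z, hL], (hNA x z y).symm⟩
end

section
/- Let A be a nearly associative L-algebra over a field K of characteristic zero. Then for all x, y, z ∈ A: (1) (x∘y)*z = z*(x∘y), i.e., A∘A is contained in the center of A⁻; (2) [x,y]∘z = 0, i.e., [A,A] is contained in the annihilator of A⁺; (3) the associator of the product ∘ satisfies (x∘y)∘z − x∘(y∘z) = (1/2)((x*y)*z − x*(y*z)) = [y, z*x]. -/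
/-- In a nearly associative L-algebra:
(1) `A∘A ⊆ Z(A⁻)`; (2) `[A,A] ⊆ ann(A⁺)`;
(3) `Asso⁺(x,y,z) = (1/2)Asso(x,y,z) = [y, z*x]`. -/
theorem stmt11 {K A : Type*} [Field K] [CharZero K] [AddCommGroup A] [Module K A]
    (mul : A →ₗ[K] A →ₗ[K] A)
    (hNA : ∀ x y z : A, mul (mul x y) z = mul y (mul z x))
    (hL : ∀ x y z : A, mul x (mul y z) = mul y (mul x z))
    (br circ : A → A → A)
    (hbr : ∀ x y : A, br x y = (2 : K)⁻¹ • (mul x y - mul y x))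
    (hcirc : ∀ x y : A, circ x y = (2 : K)⁻¹ • (mul x y + mul y x)) :
    ∀ x y z : A,
      mul (circ x y) z = mul z (circ x y) ∧
      circ (br x y) z = 0 ∧
      (circ (circ x y) z - circ x (circ y z) =
          (2 : K)⁻¹ • (mul (mul x y) z - mul x (mul y z)) ∧
        circ (circ x y) z - circ x (circ y z) = br y (mul z x)) := by
  intro x y z
  simp only [hbr, hcirc, map_add, map_sub, map_smul, LinearMap.add_apply, LinearMap.sub_apply,
    LinearMap.smul_apply, hNA]
  -- Each degree-three product now depends only on its last factor.
  rw [hL z x y, hL z y x, hL y x z]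
  refine ⟨?_, ?_, ?_, ?_⟩ <;> match_scalars <;> ring
end

section
/- Every nearly associative L-algebra A over a field K of characteristic zero is Lie-Poisson-Jordan admissible: (1) the bracket [x,y] := (1/2)(x*y − y*x) is antisymmetric and satisfies the Jacobi identity [x,[y,z]] + [y,[z,x]] + [z,[x,y]] = 0; (2) the product x∘y := (1/2)(x*y + y*x) is commutative and satisfies the Jordan identity (x∘y)∘(x∘x) = x∘(y∘(x∘x)); (3) the Leibniz compatibility [x, y∘z] = [x,y]∘z + y∘[x,z] holds for all x,y,z ∈ A. -/
/-- In a nearly associative L-algebra, `(x * y) * z = z * (y * x)`. -/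
theorem mul_mul_eq_reverse {K A : Type*} [Field K] [AddCommGroup A] [Module K A]
    (mul : A →ₗ[K] A →ₗ[K] A)
    (hNA : ∀ x y z : A, mul (mul x y) z = mul y (mul z x))
    (hL : ∀ x y z : A, mul x (mul y z) = mul y (mul x z)) (x y z : A) :
    mul (mul x y) z = mul z (mul y x) := by
  rw [hNA, hL]

/-- Every nearly associative L-algebra is Lie-Poisson-Jordan
admissible. -/
theorem stmt12 {K A : Type*} [Field K] [CharZero K] [AddCommGroup A] [Module K A]
    (mul : A →ₗ[K] A →ₗ[K] A)
    (hNA : ∀ x y z : A, mul (mul x y) z = mul y (mul z x))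
    (hL : ∀ x y z : A, mul x (mul y z) = mul y (mul x z))
    (br circ : A → A → A)
    (hbr : ∀ x y : A, br x y = (2 : K)⁻¹ • (mul x y - mul y x))
    (hcirc : ∀ x y : A, circ x y = (2 : K)⁻¹ • (mul x y + mul y x)) :
    ((∀ x y : A, br x y = - br y x) ∧
      (∀ x y z : A, br x (br y z) + br y (br z x) + br z (br x y) = 0)) ∧
    ((∀ x y : A, circ x y = circ y x) ∧
      (∀ x y : A, circ (circ x y) (circ x x) = circ x (circ y (circ x x)))) ∧
    (∀ x y z : A, br x (circ y z) = circ (br x y) z + circ y (br x z)) := by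
  have hR := mul_mul_eq_reverse mul hNA hL
  have circ_comm (x y : A) : circ x y = circ y x := by
    rw [hcirc, hcirc, add_comm]
  have circ_self (x : A) : circ x x = mul x x := by
    rw [hcirc, ← two_smul K (mul x x), smul_smul, inv_mul_cancel₀ two_ne_zero, one_smul]
  have circ_circ (x y z : A) :
      circ x (circ y z) = (2 : K)⁻¹ • (mul x (mul y z) + mul x (mul z y)) := by
    simp only [hcirc, map_add, map_smul, LinearMap.add_apply, LinearMap.smul_apply, hR]
    module
  have br_br (x y z : A) :
      br x (br y z) = (2 : K)⁻¹ • (mul x (mul y z) - mul x (mul z y)) := by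
    simp only [hbr, map_sub, map_smul, LinearMap.sub_apply, LinearMap.smul_apply, hR]
    module
  have br_circ (x y z : A) : br x (circ y z) = 0 := by
    simp only [hbr, hcirc, map_add, map_smul, LinearMap.add_apply, LinearMap.smul_apply, hR]
    module
  have circ_br (x y z : A) : circ x (br y z) = 0 := by
    simp only [hbr, hcirc, map_sub, map_smul, LinearMap.sub_apply, LinearMap.smul_apply, hR]
    module
  refine ⟨⟨fun x y ↦ ?_, fun x y z ↦ ?_⟩, ⟨circ_comm, fun x y ↦ ?_⟩, fun x y z ↦ ?_⟩
  · rw [hbr, hbr, ← smul_neg, neg_sub]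
  · rw [br_br, br_br, br_br, hL y x z, hL z x y, hL z y x]
    module
  · rw [circ_comm, circ_self, circ_circ, circ_circ, hL (mul x x) x y, hL (mul x x) y x,
      hR x x x, hL y x (mul x x), add_comm]
  · rw [br_circ, circ_comm (br x y) z, circ_br, circ_br, add_zero]
end

section
/- If A is a nearly associative L-algebra over a field K of characteristic zero, then the commutator algebra A⁻ is a 3-nilpotent Lie algebra: [[[x,y],z],t] = 0 for all x, y, z, t ∈ A, where [a,b] := (1/2)(a*b − b*a). -/
/-- In a nearly associative L-algebra, right-normed products of length four do not depend on the
order of the two innermost factors. -/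
theorem mul_mul_mul_comm_of_nearlyAssociative_of_L {A : Type*} (mul : A → A → A)
    (hNA : ∀ x y z : A, mul (mul x y) z = mul y (mul z x))
    (hL : ∀ x y z : A, mul x (mul y z) = mul y (mul x z)) (t z y x : A) :
    mul t (mul z (mul y x)) = mul t (mul z (mul x y)) :=
  calc
    mul t (mul z (mul y x)) = mul y (mul t (mul z x)) := by rw [hL z y x, hL t y]
    _ = mul y (mul (mul x t) z) := by rw [hNA x t z]
    _ = mul (mul x t) (mul y z) := hL _ _ _
    _ = mul t (mul (mul y z) x) := hNA _ _ _
    _ = mul t (mul z (mul x y)) := by rw [hNA y z x]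

/-- For a nearly associative L-algebra, `A⁻` is a 3-nilpotent
Lie algebra: `[[[x,y],z],t] = 0`. -/
theorem stmt13 {K A : Type*} [Field K] [CharZero K] [AddCommGroup A] [Module K A]
    (mul : A →ₗ[K] A →ₗ[K] A)
    (hNA : ∀ x y z : A, mul (mul x y) z = mul y (mul z x))
    (hL : ∀ x y z : A, mul x (mul y z) = mul y (mul x z))
    (br : A → A → A)
    (hbr : ∀ x y : A, br x y = (2 : K)⁻¹ • (mul x y - mul y x)) :
    ∀ x y z t : A, br (br (br x y) z) t = 0 := by
  have br_mul (x y z : A) : mul (br x y) z = -mul z (br x y) := by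
    simp only [hbr, map_smul, map_sub, LinearMap.smul_apply, LinearMap.sub_apply, hNA]
    rw [hL y z x, hL x z y]
    module
  have mul_mul_br (t z x y : A) : mul t (mul z (br x y)) = 0 := by
    have h := mul_mul_mul_comm_of_nearlyAssociative_of_L (fun a b ↦ mul a b) hNA hL t z x y
    simp only [hbr, map_smul, map_sub, h, sub_self, smul_zero]
  intro x y z t
  have mul_br_br : mul t (br (br x y) z) = 0 := by
    rw [hbr (br x y) z, br_mul x y z, map_smul, map_sub, map_neg, mul_mul_br, neg_zero, sub_zero,
      smul_zero]
  rw [hbr, br_mul, mul_br_br, neg_zero, sub_zero, smul_zero]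
end

section
/- Let A be a nearly associative L-algebra over a field K of characteristic zero. Then the following conditions are equivalent: (1) A is associative, i.e., (x*y)*z = x*(y*z) for all x,y,z; (2) the symmetrized product x∘y := (1/2)(x*y + y*x) is associative (so A⁺ is a commutative associative algebra); (3) the commutator algebra A⁻ is 2-nilpotent, i.e., [[x,y],z] = 0 for all x,y,z, where [a,b] := (1/2)(a*b − b*a). -/
/-- For a nearly associative L-algebra, the following are
equivalent: `A` associative; `A⁺` associative; `A⁻` 2-nilpotent. -/
theorem stmt14 {K A : Type*} [Field K] [CharZero K] [AddCommGroup A] [Module K A]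
    (mul : A →ₗ[K] A →ₗ[K] A)
    (hNA : ∀ x y z : A, mul (mul x y) z = mul y (mul z x))
    (hL : ∀ x y z : A, mul x (mul y z) = mul y (mul x z))
    (br circ : A → A → A)
    (hbr : ∀ x y : A, br x y = (2 : K)⁻¹ • (mul x y - mul y x))
    (hcirc : ∀ x y : A, circ x y = (2 : K)⁻¹ • (mul x y + mul y x)) :
    ((∀ x y z : A, mul (mul x y) z = mul x (mul y z)) ↔
      (∀ x y z : A, circ (circ x y) z = circ x (circ y z))) ∧
    ((∀ x y z : A, circ (circ x y) z = circ x (circ y z)) ↔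
      (∀ x y z : A, br (br x y) z = 0)) := by
  have half_add : ∀ a b : A, (2 : K)⁻¹ • ((2 : K)⁻¹ • (a + b) + (2 : K)⁻¹ • (b + a))
      = (2 : K)⁻¹ • (a + b) := by
    intro a b
    module
  have circ_left : ∀ x y z : A, circ (circ x y) z
      = (2 : K)⁻¹ • (mul y (mul z x) + mul x (mul z y)) := by
    intro x y z
    simp only [hcirc, map_smul, map_add, LinearMap.smul_apply, LinearMap.add_apply]
    rw [hNA x y z, hNA y x z, hL z x y, hL z y x, hL y z x, hL x z y]
    exact half_add _ _
  have circ_right : ∀ x y z : A, circ x (circ y z)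
      = (2 : K)⁻¹ • (mul x (mul y z) + mul x (mul z y)) := by
    intro x y z
    simp only [hcirc, map_smul, map_add, LinearMap.smul_apply, LinearMap.add_apply]
    rw [hNA y z x, hNA z y x, hL z x y, hL y x z]
    exact half_add _ _
  have br_left : ∀ x y z : A, br (br x y) z
      = (2 : K)⁻¹ • (mul y (mul z x) - mul x (mul z y)) := by
    intro x y z
    simp only [hbr, map_smul, map_sub, LinearMap.smul_apply, LinearMap.sub_apply]
    rw [hNA x y z, hNA y x z, hL z x y, hL z y x, hL y z x, hL x z y]
    module
  have h2 : (2 : K)⁻¹ ≠ 0 := inv_ne_zero two_ne_zero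
  have assoc_iff_circ : (∀ x y z : A, mul (mul x y) z = mul x (mul y z)) ↔
      (∀ x y z : A, circ (circ x y) z = circ x (circ y z)) := by
    refine forall₃_congr fun x y z => ?_
    rw [circ_left, circ_right, hNA x y z, (smul_right_injective A h2).eq_iff, add_left_inj]
  refine ⟨assoc_iff_circ, assoc_iff_circ.symm.trans ?_⟩
  have br_iff : ∀ x y z : A, br (br x y) z = 0 ↔ mul (mul x z) y = mul x (mul z y) := by
    intro x y z
    rw [br_left, smul_eq_zero_iff_right h2, sub_eq_zero, hNA x z y, hL z y x]
  exact ⟨fun h x y z => (br_iff x y z).2 (h x z y), fun h x y z => (br_iff x z y).1 (h x z y)⟩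
end

section
/- A (not necessarily associative or unital) algebra A over a field K of characteristic zero is a nearly associative L-algebra if and only if the following four conditions hold: (1) the bracket [x,y] := (1/2)(x*y − y*x) satisfies the Jacobi identity, so A⁻ is a Lie algebra; (2) (x∘y)*z = z*(x∘y) for all x,y,z ∈ A, i.e., A∘A ⊆ Z(A⁻); (3) [x,y]∘z = 0 for all x,y,z ∈ A, i.e., [A,A] ⊆ ann(A⁺); (4) the associator of ∘ satisfies (x∘y)∘z − x∘(y∘z) = [y, z*x] for all x,y,z ∈ A. -/
/-- An algebra is a nearly associative L-algebra iff:
(1) `A⁻` is a Lie algebra; (2) `A∘A ⊆ Z(A⁻)`; (3) `[A,A] ⊆ ann(A⁺)`;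
(4) `Asso⁺(x,y,z) = [y, z*x]`. -/
theorem stmt15 {K A : Type*} [Field K] [CharZero K] [AddCommGroup A] [Module K A]
    (mul : A →ₗ[K] A →ₗ[K] A)
    (br circ : A → A → A)
    (hbr : ∀ x y : A, br x y = (2 : K)⁻¹ • (mul x y - mul y x))
    (hcirc : ∀ x y : A, circ x y = (2 : K)⁻¹ • (mul x y + mul y x)) :
    ((∀ x y z : A, mul (mul x y) z = mul y (mul z x)) ∧
      (∀ x y z : A, mul x (mul y z) = mul y (mul x z))) ↔
    (((∀ x y : A, br x y = - br y x) ∧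
        (∀ x y z : A, br x (br y z) + br y (br z x) + br z (br x y) = 0)) ∧
      (∀ x y z : A, mul (circ x y) z = mul z (circ x y)) ∧
      (∀ x y z : A, circ (br x y) z = 0) ∧
      (∀ x y z : A, circ (circ x y) z - circ x (circ y z) = br y (mul z x))) := by
  constructor
  · rintro ⟨h1, h2⟩
    refine ⟨⟨fun x y => ?_, fun x y z => ?_⟩, fun x y z => ?_, fun x y z => ?_, fun x y z => ?_⟩
    · simp only [hbr]
      module
    · simp only [hbr, map_sub, map_smul, LinearMap.sub_apply, LinearMap.smul_apply]
      linear_combination (norm := module)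
        (-1/4 : K) • h1 x y z + (1/4 : K) • h1 x z y + (1/4 : K) • h1 y x z +
        (-1/4 : K) • h1 y z x + (-1/4 : K) • h1 z x y + (1/4 : K) • h1 z y x
    · simp only [hcirc, map_add, map_smul, LinearMap.add_apply, LinearMap.smul_apply]
      linear_combination (norm := module)
        (1/2 : K) • h1 x y z + (1/2 : K) • h1 y x z + (1/2 : K) • h2 x z y +
        (1/2 : K) • h2 y z x
    · simp only [hbr, hcirc, map_sub, map_smul, LinearMap.sub_apply, LinearMap.smul_apply]
      linear_combination (norm := module)
        (1/4 : K) • h1 x y z + (-1/4 : K) • h1 y x z + (-1/4 : K) • h2 x z y +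
        (1/4 : K) • h2 y z x
    · simp only [hbr, hcirc, map_add, map_smul, LinearMap.add_apply, LinearMap.smul_apply]
      linear_combination (norm := module)
        (1/4 : K) • h1 x y z + (1/4 : K) • h1 y x z + (-1/4 : K) • h1 y z x +
        (1/2 : K) • h1 z x y + (-1/4 : K) • h1 z y x + (1/4 : K) • h2 x y z +
        (-1/4 : K) • h2 y z x
  · rintro ⟨⟨-, hJ⟩, hZ, hA, hS⟩
    simp only [hbr, hcirc, map_add, map_sub, map_smul, LinearMap.add_apply, LinearMap.sub_apply,
      LinearMap.smul_apply] at hJ hZ hA hS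
    refine ⟨fun x y z => ?_, fun x y z => ?_⟩
    · linear_combination (norm := module)
        hZ x y z + hA x y z + hA x z y +
        hS x y z - hS x z y
    · linear_combination (norm := module)
        hJ x y z + (1/2 : K) • hZ x y z + (1/2 : K) • hZ x z y +
        (-1/2 : K) • hZ y z x - hA x z y + hA y z x -
        hS x z y
end

section
/- Let A be a finite-dimensional vector space over a field K of characteristic zero carrying a multiplication · making (A, ·) a nearly associative L-algebra, and let ⋆ be a multiplication on the dual A* making (A*, ⋆) a nearly associative L-algebra. Let Δ : A → A ⊗ A be the transpose of ⋆, determined by (f ⊗ g)(Δ(x)) = (f ⋆ g)(x) for all x ∈ A, f, g ∈ A*. On D(A) := A ⊕ A* define the product (x + f) ⋄ (y + g) := (x·y + L*_f(y) + R*_g(x)) + (f⋆g + L*_x(g) + R*_y(f)), where L*_x(g) := g ∘ R_x and R*_y(f) := f ∘ L_y (with L, R the multiplication operators of ·), and L*_f(y), R*_g(x) ∈ A are determined via the canonical identification of A with its bidual by h(L*_f(y)) = (h ⋆ f)(y) and h(R*_g(x)) = (g ⋆ h)(x) for all h ∈ A*. Then (D(A), ⋄) is a nearly associative algebra if and only if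 for all x, y ∈ A: Δ(x·y) = (I ⊗ R_y)Δ(x) + τ(I ⊗ R_x)Δ(y) = τ(L_y ⊗ I)Δ(x) + (L_x ⊗ I)Δ(y), and (R_y ⊗ I)Δ(x) + (I ⊗ L_x)Δ(y) = (I ⊗ L_y)Δ(x) + (R_x ⊗ I)Δ(y) = τ(I ⊗ L_y)Δ(x) + τ(R_x ⊗ I)Δ(y). -/
open TensorProduct

/-- Tensors over a finite-dimensional space are separated by pure tensors of functionals. -/
theorem tensor_eq_iff_forall_dual {K A : Type*} [Field K] [AddCommGroup A] [Module K A]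
    [FiniteDimensional K A] (t u : A ⊗[K] A) :
    t = u ↔ ∀ f g : Module.Dual K A, TensorProduct.lid K K (TensorProduct.map f g t) =
      TensorProduct.lid K K (TensorProduct.map f g u) := by
  refine ⟨fun h f g => by rw [h], fun h => ?_⟩
  let b := Module.finBasis K A
  have key : ∀ (v : A ⊗[K] A) (i j), (b.tensorProduct b).repr v (i, j) =
      TensorProduct.lid K K (TensorProduct.map (b.coord i) (b.coord j) v) := by
    intro v i j
    induction v with
    | zero => simp
    | tmul x y => simp [mul_comm]
    | add x y hx hy => simp only [map_add, Finsupp.add_apply, hx, hy]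
  refine (b.tensorProduct b).ext_elem ?_
  rintro ⟨i, j⟩
  rw [key, key, h]

/-- Characterization of nearly associative bialgebras: the Drinfeld
double `D(A) = A ⊕ A*` is nearly associative iff the comultiplication `Δ`
(the transpose of the multiplication `⋆` of `A*`) satisfies the two chains of
compatibility conditions. -/
theorem stmt18 {K A : Type*} [Field K] [CharZero K] [AddCommGroup A] [Module K A]
    [FiniteDimensional K A]
    (mul : A →ₗ[K] A →ₗ[K] A)
    (hNA : ∀ x y z : A, mul (mul x y) z = mul y (mul z x))
    (hLalg : ∀ x y z : A, mul x (mul y z) = mul y (mul x z))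
    (star : Module.Dual K A →ₗ[K] Module.Dual K A →ₗ[K] Module.Dual K A)
    (hstarNA : ∀ f g h : Module.Dual K A, star (star f g) h = star g (star h f))
    (hstarL : ∀ f g h : Module.Dual K A, star f (star g h) = star g (star f h))
    (Δ : A →ₗ[K] A ⊗[K] A)
    (hΔ : ∀ (x : A) (f g : Module.Dual K A),
      TensorProduct.lid K K (TensorProduct.map f g (Δ x)) = star f g x)
    (τ : A ⊗[K] A →ₗ[K] A ⊗[K] A)
    (hτ : ∀ x y : A, τ (x ⊗ₜ[K] y) = y ⊗ₜ[K] x)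
    (Lstar Rstar : Module.Dual K A → A → A)
    (hLstar : ∀ (f : Module.Dual K A) (y : A) (h : Module.Dual K A),
      h (Lstar f y) = star h f y)
    (hRstar : ∀ (g : Module.Dual K A) (x : A) (h : Module.Dual K A),
      h (Rstar g x) = star g h x)
    (dmul : A × Module.Dual K A → A × Module.Dual K A → A × Module.Dual K A)
    (hdmul : ∀ p q : A × Module.Dual K A,
      dmul p q = (mul p.1 q.1 + Lstar p.2 q.1 + Rstar q.2 p.1,
        star p.2 q.2 + LinearMap.comp q.2 (mul.flip p.1) +
          LinearMap.comp p.2 (mul q.1))) :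
    (∀ p q s : A × Module.Dual K A, dmul (dmul p q) s = dmul q (dmul s p)) ↔
    (∀ x y : A,
      (Δ (mul x y) =
          TensorProduct.map (LinearMap.id : A →ₗ[K] A) (mul.flip y) (Δ x) +
            τ (TensorProduct.map (LinearMap.id : A →ₗ[K] A) (mul.flip x) (Δ y)) ∧
        Δ (mul x y) =
          τ (TensorProduct.map (mul y) (LinearMap.id : A →ₗ[K] A) (Δ x)) +
            TensorProduct.map (mul x) (LinearMap.id : A →ₗ[K] A) (Δ y)) ∧
      (TensorProduct.map (mul.flip y) (LinearMap.id : A →ₗ[K] A) (Δ x) +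
            TensorProduct.map (LinearMap.id : A →ₗ[K] A) (mul x) (Δ y) =
          TensorProduct.map (LinearMap.id : A →ₗ[K] A) (mul y) (Δ x) +
            TensorProduct.map (mul.flip x) (LinearMap.id : A →ₗ[K] A) (Δ y) ∧
        TensorProduct.map (LinearMap.id : A →ₗ[K] A) (mul y) (Δ x) +
            TensorProduct.map (mul.flip x) (LinearMap.id : A →ₗ[K] A) (Δ y) =
          τ (TensorProduct.map (LinearMap.id : A →ₗ[K] A) (mul y) (Δ x)) +
            τ (TensorProduct.map (mul.flip x) (LinearMap.id : A →ₗ[K] A) (Δ y)))) := by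
  have pair_map (f g : Module.Dual K A) (φ ψ : A →ₗ[K] A) (x : A) :
      TensorProduct.lid K K (TensorProduct.map f g (TensorProduct.map φ ψ (Δ x))) =
        star (f ∘ₗ φ) (g ∘ₗ ψ) x := by
    rw [← hΔ, TensorProduct.map_comp, LinearMap.comp_apply]
  have pair_swap (f g : Module.Dual K A) (t : A ⊗[K] A) :
      TensorProduct.lid K K (TensorProduct.map f g (τ t)) =
        TensorProduct.lid K K (TensorProduct.map g f t) := by
    induction t with
    | zero => simp
    | tmul x y => simp [hτ, mul_comm]
    | add x y hx hy => simp only [map_add, hx, hy]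
  simp only [tensor_eq_iff_forall_dual, map_add, pair_swap, pair_map, hΔ, LinearMap.comp_id]
  let B : A × Module.Dual K A → A × Module.Dual K A → K := fun p q => p.2 q.1 + q.2 p.1
  have B_ext (p q : A × Module.Dual K A) (h : ∀ t, B p t = B q t) : p = q := by
    refine Prod.ext ?_ ?_
    · rw [← sub_eq_zero, ← Module.forall_dual_apply_eq_zero_iff K]
      intro f
      simpa [B, sub_eq_zero] using h (0, f)
    · ext z
      simpa [B] using h (z, 0)
  have B_mul (p q t : A × Module.Dual K A) : B (dmul p q) t = B p (dmul q t) := by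
    simp only [B, hdmul, LinearMap.add_apply, map_add, LinearMap.comp_apply, hLstar, hRstar,
      LinearMap.flip_apply]
    ring
  have B_mul' (p q t : A × Module.Dual K A) : B (dmul p q) t = B q (dmul t p) := by
    simp only [B, hdmul, LinearMap.add_apply, map_add, LinearMap.comp_apply, hLstar, hRstar,
      LinearMap.flip_apply]
    ring
  have nearlyAssoc_iff : (∀ p q s, dmul (dmul p q) s = dmul q (dmul s p)) ↔
      ∀ p q s t, B (dmul p q) (dmul s t) = B (dmul s p) (dmul t q) := by
    constructor
    · intro h p q s t
      rw [← B_mul, h, B_mul']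
    · intro h p q s
      refine B_ext _ _ fun t => ?_
      have key := h p q s t
      rwa [← B_mul, ← B_mul' q (dmul s p) t] at key
  have B_expand (p q s t : A × Module.Dual K A) : B (dmul p q) (dmul s t) =
      star p.2 q.2 (mul s.1 t.1) + q.2 (mul (mul s.1 t.1) p.1) + p.2 (mul q.1 (mul s.1 t.1))
      + star (star p.2 q.2) s.2 t.1 + star (q.2 ∘ₗ mul.flip p.1) s.2 t.1
      + star (p.2 ∘ₗ mul q.1) s.2 t.1
      + star t.2 (star p.2 q.2) s.1 + star t.2 (q.2 ∘ₗ mul.flip p.1) s.1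
      + star t.2 (p.2 ∘ₗ mul q.1) s.1
      + star s.2 t.2 (mul p.1 q.1) + t.2 (mul (mul p.1 q.1) s.1) + s.2 (mul t.1 (mul p.1 q.1))
      + star (star s.2 t.2) p.2 q.1 + star (t.2 ∘ₗ mul.flip s.1) p.2 q.1
      + star (s.2 ∘ₗ mul t.1) p.2 q.1
      + star q.2 (star s.2 t.2) p.1 + star q.2 (t.2 ∘ₗ mul.flip s.1) p.1
      + star q.2 (s.2 ∘ₗ mul t.1) p.1 := by
    simp only [B, hdmul, map_add, hLstar, hRstar, LinearMap.add_apply, LinearMap.comp_apply,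
      LinearMap.flip_apply]
    ring
  rw [nearlyAssoc_iff]
  simp only [B_expand]
  constructor
  · intro h x y
    have h₁ (x y : A) (f g : Module.Dual K A) := h (0, f) (0, g) (x, 0) (y, 0)
    have h₂ (x y : A) (f g : Module.Dual K A) := h (x, 0) (y, 0) (0, f) (0, g)
    have h₃ (x y : A) (f g : Module.Dual K A) := h (x, 0) (0, f) (0, g) (y, 0)
    have h₄ (x y : A) (f g : Module.Dual K A) := h (0, f) (x, 0) (y, 0) (0, g)
    simp only [map_zero, LinearMap.zero_apply, LinearMap.zero_comp, LinearMap.comp_zero,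
      add_zero, zero_add] at h₁ h₂ h₃ h₄
    refine ⟨⟨fun f g => ?_, fun f g => ?_⟩, fun f g => ?_, fun f g => ?_⟩
    · linear_combination h₁ x y f g
    · linear_combination h₂ x y f g
    · linear_combination -h₃ x y f g
    · linear_combination h₃ x y f g - h₄ x y f g + h₃ y x g f
  · intro h p q s t
    have h₁ (x y : A) := (h x y).1.1
    have h₂ (x y : A) := (h x y).1.2
    have h₃ (x y : A) := (h x y).2.1
    have h₄ (x y : A) := (h x y).2.2
    have mul_right_comm' (x y z : A) : mul (mul x y) z = mul (mul x z) y := by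
      rw [hNA, hLalg, ← hNA]
    have star_right_comm (f g k : Module.Dual K A) : star (star f g) k = star (star f k) g := by
      rw [hstarNA, hstarL, ← hstarNA]
    rw [hNA p.1 q.1 s.1, mul_right_comm' s.1 t.1 p.1, hLalg t.1 p.1 q.1, ← hNA t.1 q.1 s.1,
      hstarNA p.2 q.2 s.2, star_right_comm s.2 t.2 p.2, hstarL t.2 p.2 q.2,
      ← hstarNA t.2 q.2 s.2]
    linear_combination h₁ s.1 t.1 p.2 q.2 + h₂ p.1 q.1 s.2 t.2 - h₃ p.1 t.1 q.2 s.2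
      - h₂ t.1 q.1 s.2 p.2 - h₁ s.1 p.1 t.2 q.2 + h₄ s.1 q.1 t.2 p.2
end

section
/- Let A be a finite-dimensional nearly associative L-algebra over a field K of characteristic zero and let r = Σᵢ aᵢ ⊗ bᵢ ∈ A ⊗ A be skew-symmetric, i.e., τ(r) = −r. Define the linear map ℛ : A* → A by ℛ(f) := (f ⊗ I)(r) = Σᵢ f(aᵢ) bᵢ. Then r is a solution of the LR-Yang-Baxter equation, i.e., LR(r) := r₁₂r₂₃ − r₁₃r₁₂ − r₂₃r₁₃ = 0, if and only if ℛ(f) = −Σᵢ f(bᵢ) aᵢ for all f ∈ A* and the cyclic condition f(ℛ(h)*ℛ(g)) + g(ℛ(f)*ℛ(h)) + h(ℛ(g)*ℛ(f)) = 0 holds for all f, g, h ∈ A*. -/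
open TensorProduct

/-- The pure tensors `f ⊗ g ⊗ h` of functionals separate the points of `A ⊗ (A ⊗ A)`. -/
theorem eq_zero_iff_forall_dualDistrib {K A : Type*} [Field K] [AddCommGroup A] [Module K A]
    (x : A ⊗[K] (A ⊗[K] A)) :
    x = 0 ↔ ∀ f g h : Module.Dual K A,
      TensorProduct.dualDistrib K A (A ⊗[K] A) (f ⊗ₜ[K] TensorProduct.dualDistrib K A A (g ⊗ₜ[K] h)) x = 0 := by
  refine ⟨fun hx f g h => by rw [hx, map_zero], fun H => ?_⟩
  let e := Module.Free.chooseBasis K A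
  let E := e.tensorProduct (e.tensorProduct e)
  have key : ∀ i j k, E.coord (i, j, k) =
      TensorProduct.dualDistrib K A (A ⊗[K] A)
        (e.coord i ⊗ₜ[K] TensorProduct.dualDistrib K A A (e.coord j ⊗ₜ[K] e.coord k)) := by
    intro i j k
    ext u v w
    simp [E, mul_comm]
  refine E.forall_coord_eq_zero_iff.1 fun ⟨i, j, k⟩ => ?_
  rw [key]
  exact H _ _ _

/-- Expansion of a functional applied to a product of two linear combinations. -/
theorem apply_mul_sum_smul {K A ι : Type*} [Field K] [AddCommGroup A] [Module K A] [Fintype ι]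
    (mul : A →ₗ[K] A →ₗ[K] A) (φ : Module.Dual K A) (s t : ι → K) (u v : ι → A) :
    φ (mul (∑ i, s i • u i) (∑ j, t j • v j)) =
      ∑ i, ∑ j, s i * (t j * φ (mul (u i) (v j))) := by
  simp only [map_sum, map_smul, LinearMap.sum_apply, LinearMap.smul_apply, smul_eq_mul,
    Finset.mul_sum]
  rw [Finset.sum_comm]
  exact Finset.sum_congr rfl fun i _ => Finset.sum_congr rfl fun j _ => by ring

/-- For a skew-symmetric `r = Σᵢ aᵢ ⊗ bᵢ` in a finite-dimensional
nearly associative L-algebra, `r` solves the LR-Yang-Baxter equation iff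
`ℛ(f) = −Σᵢ f(bᵢ) aᵢ` and the cyclic condition
`Σ_cycl ⟨f, ℛ(h)ℛ(g)⟩ = 0` holds. -/
theorem stmt19 {K A ι : Type*} [Field K] [CharZero K] [AddCommGroup A] [Module K A]
    [FiniteDimensional K A] [Fintype ι]
    (mul : A →ₗ[K] A →ₗ[K] A)
    (hNA : ∀ x y z : A, mul (mul x y) z = mul y (mul z x))
    (hL : ∀ x y z : A, mul x (mul y z) = mul y (mul x z))
    (a b : ι → A)
    (τ : A ⊗[K] A →ₗ[K] A ⊗[K] A)
    (hτ : ∀ x y : A, τ (x ⊗ₜ[K] y) = y ⊗ₜ[K] x)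
    (hskew : τ (∑ i, a i ⊗ₜ[K] b i) = - ∑ i, a i ⊗ₜ[K] b i)
    (R : Module.Dual K A → A)
    (hR : ∀ f : Module.Dual K A, R f = ∑ i, f (a i) • b i) :
    ((∑ i, ∑ j, a i ⊗ₜ[K] (mul (b i) (a j) ⊗ₜ[K] b j)) -
        (∑ i, ∑ j, mul (a i) (a j) ⊗ₜ[K] (b j ⊗ₜ[K] b i)) -
        (∑ i, ∑ j, a j ⊗ₜ[K] (a i ⊗ₜ[K] mul (b i) (b j))) = 0) ↔
    ((∀ f : Module.Dual K A, R f = - ∑ i, f (b i) • a i) ∧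
      (∀ f g h : Module.Dual K A,
        f (mul (R h) (R g)) + g (mul (R f) (R h)) + h (mul (R g) (R f)) = 0)) := by
  have hneg : ∀ f : Module.Dual K A, R f = - ∑ i, f (b i) • a i := by
    intro f
    have := congrArg (TensorProduct.lid K A ∘ f.rTensor A) hskew
    simp only [Function.comp_apply, map_sum, map_neg, hτ, LinearMap.rTensor_tmul,
      TensorProduct.lid_tmul] at this
    rw [hR, this, neg_neg]
  have hR' : ∀ f : Module.Dual K A, ∑ i, f (b i) • a i = - R f := fun f => by
    rw [hneg f, neg_neg]
  have eval : ∀ f g h : Module.Dual K A,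
      TensorProduct.dualDistrib K A (A ⊗[K] A) (f ⊗ₜ[K] TensorProduct.dualDistrib K A A (g ⊗ₜ[K] h))
        ((∑ i, ∑ j, a i ⊗ₜ[K] (mul (b i) (a j) ⊗ₜ[K] b j)) -
          (∑ i, ∑ j, mul (a i) (a j) ⊗ₜ[K] (b j ⊗ₜ[K] b i)) -
          (∑ i, ∑ j, a j ⊗ₜ[K] (a i ⊗ₜ[K] mul (b i) (b j)))) =
      -(f (mul (R h) (R g)) + g (mul (R f) (R h)) + h (mul (R g) (R f))) := by
    intro f g h
    have h₁ : ∑ i, ∑ j, f (a i) * (g (mul (b i) (a j)) * h (b j)) = - g (mul (R f) (R h)) := by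
      rw [← map_neg g, ← map_neg (mul (R f)), ← hR' h, hR f, apply_mul_sum_smul]
      simp only [mul_comm (h _)]
    have h₂ : ∑ i, ∑ j, f (mul (a i) (a j)) * (g (b j) * h (b i)) = f (mul (R h) (R g)) := by
      have : mul (R h) (R g) = mul (- R h) (- R g) := by simp
      rw [this, ← hR' h, ← hR' g, apply_mul_sum_smul]
      exact Finset.sum_congr rfl fun i _ => Finset.sum_congr rfl fun j _ => by ring
    have h₃ : ∑ i, ∑ j, f (a j) * (g (a i) * h (mul (b i) (b j))) = h (mul (R g) (R f)) := by
      rw [hR g, hR f, apply_mul_sum_smul]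
      exact Finset.sum_congr rfl fun i _ => Finset.sum_congr rfl fun j _ => by ring
    simp only [map_sub, map_sum, TensorProduct.dualDistrib_apply]
    rw [h₁, h₂, h₃]
    ring
  rw [eq_zero_iff_forall_dualDistrib]
  simp only [eval, neg_eq_zero]
  exact ⟨fun H => ⟨hneg, H⟩, fun H => H.2⟩
end
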